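/- arXiv:2105.03466 — 4 statements merged into one kernel-verified Lean document; each statement's English description precedes it below -/
import Mathlib

section
/- Define f : ℕ_{>0} → ℝ by f(p) = (√(p² + 2p − 3) − p + 3)/2. Then for every rooted tree T of order n, μ(T) ≥ ρ(T) − f(n), with equality if and only if T is (isomorphic as a rooted tree to) the rooted star S_n. -/
open Matrix SimpleGraph
open scoped Kronecker

attribute [local instance 10] Classical.propDecidable

/-- A rooted tree: a tree (connected acyclic simple graph) with a distinguished root. -/
structure RTree (V : Type) where
  G : SimpleGraph V
  isTree : G.IsTree
  root : V

namespace RTree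

variable {V : Type}

/-- `T.pord j i` means `j ⪯ i`: the (unique) path joining `j` to the root contains `i`. -/
def pord (T : RTree V) (j i : V) : Prop :=
  T.G.dist j T.root = T.G.dist j i + T.G.dist i T.root

/-- The path matrix `N`: the `(i,j)` entry is `1` if `j ⪯ i` and `0` otherwise. -/
noncomputable def pathMatrix (T : RTree V) : Matrix V V ℝ :=
  Matrix.of fun i j => if T.pord j i then 1 else 0

/-- The bottleneck matrix `M = NᵀN`: the `(i,j)` entry is the number of vertices lying
simultaneously on the path from `i` to the root and on the path from `j` to the root. -/
noncomputable def bottleneck (T : RTree V) : Matrix V V ℝ :=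
  Matrix.of fun i j => (Nat.card {v : V | T.pord i v ∧ T.pord j v} : ℝ)

/-- The neckbottle matrix `Q = N Nᵀ`. -/
noncomputable def neckbottle [Fintype V] (T : RTree V) : Matrix V V ℝ :=
  T.pathMatrix * T.pathMatrixᵀ

/-- The Perron value of a rooted tree: the largest eigenvalue of its bottleneck matrix. -/
noncomputable def perron [Fintype V] (T : RTree V) : ℝ :=
  sSup {t : ℝ | ∃ w : V → ℝ, w ≠ 0 ∧ T.bottleneck *ᵥ w = t • w}

/-- The degree of a vertex. -/
noncomputable def degree (T : RTree V) (v : V) : ℕ :=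
  Nat.card {u : V | T.G.Adj v u}

/-- The moment `μ(T) = ∑ᵥ dist(v, root) · deg(v)`. -/
noncomputable def moment [Fintype V] (T : RTree V) : ℕ :=
  ∑ v : V, T.G.dist v T.root * T.degree v

/-- The root-transmission `t(T) = ∑ᵥ dist(v, root)`. -/
noncomputable def transmission [Fintype V] (T : RTree V) : ℕ :=
  ∑ v : V, T.G.dist v T.root

end RTree


namespace RTree

variable {V : Type}

lemma pord_self (T : RTree V) (i : V) : T.pord i i := by simp [pord]

lemma pord_root (T : RTree V) (i : V) : T.pord i T.root := by simp [pord]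

lemma pord_unique (T : RTree V) {i k k' : V} (h : T.pord i k) (h' : T.pord i k')
    (hd : T.G.dist k T.root = T.G.dist k' T.root) : k = k' := by
  have key : ∀ k : V, T.pord i k → ∃ p : T.G.Walk i T.root, p.IsPath ∧
      p.getVert (T.G.dist i k) = k := by
    intro k hk
    obtain ⟨p, hp⟩ := T.isTree.connected.exists_walk_length_eq_dist i k
    obtain ⟨q, hq⟩ := T.isTree.connected.exists_walk_length_eq_dist k T.root
    refine ⟨p.append q, ?_, ?_⟩
    · apply Walk.isPath_of_length_eq_dist
      rw [Walk.length_append, hp, hq]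
      exact hk.symm
    · rw [Walk.getVert_append]
      simp [hp]
  obtain ⟨p, hp, e⟩ := key k h
  obtain ⟨q, hq, e'⟩ := key k' h'
  have hpq : p = q := (T.isTree.existsUnique_path _ _).unique hp hq
  unfold pord at h h'
  have : T.G.dist i k = T.G.dist i k' := by omega
  rw [← e, ← e', hpq, this]

/-- u is the parent of v -/
def par (T : RTree V) (v u : V) : Prop :=
  T.G.Adj v u ∧ T.G.dist u T.root + 1 = T.G.dist v T.root

lemma par_pord (T : RTree V) {v u : V} (h : T.par v u) : T.pord v u := by
  have := dist_eq_one_iff_adj.mpr h.1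
  have := h.2
  unfold pord; omega

lemma par_unique (T : RTree V) {v u u' : V} (h : T.par v u) (h' : T.par v u') : u = u' := by
  apply T.pord_unique (T.par_pord h) (T.par_pord h')
  have := h.2
  have := h'.2
  omega

lemma par_exists (T : RTree V) {v : V} (hv : v ≠ T.root) : ∃ u, T.par v u := by
  obtain ⟨p, hp⟩ := T.isTree.connected.exists_walk_length_eq_dist v T.root
  cases p with
  | nil => exact absurd rfl hv
  | @cons _ u _ h q =>
    refine ⟨u, h, ?_⟩
    rw [Walk.length_cons] at hp
    have h1 := dist_le q
    have h2 := T.isTree.connected.dist_triangle (u := v) (v := u) (w := T.root)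
    have h3 := dist_eq_one_iff_adj.mpr h
    omega

lemma not_par_root (T : RTree V) (u : V) : ¬ T.par T.root u := by
  intro h
  have := h.2
  simp at this

lemma adj_iff (T : RTree V) (v u : V) : T.G.Adj v u ↔ T.par v u ∨ T.par u v := by
  constructor
  · intro h
    have h1 := T.isTree.dist_ne_of_adj T.root h
    have h2 := h.diff_dist_adj (u := T.root)
    rw [dist_comm (u := T.root), dist_comm (u := T.root)] at h1 h2
    by_cases hc : T.G.dist u T.root + 1 = T.G.dist v T.root
    · exact Or.inl ⟨h, hc⟩
    · exact Or.inr ⟨h.symm, by omega⟩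
  · rintro (h | h)
    · exact h.1
    · exact h.1.symm

lemma not_both (T : RTree V) {v u : V} (h : T.par v u) (h' : T.par u v) : False := by
  have := h.2
  have := h'.2
  omega

variable [Fintype V]

lemma sum_par (T : RTree V) (v : V) (c : ℝ) :
    ∑ u, (if T.par v u then c else 0) = if v = T.root then 0 else c := by
  split_ifs with h
  · subst h
    simp [T.not_par_root]
  · obtain ⟨u, hu⟩ := T.par_exists h
    rw [Finset.sum_eq_single u]
    · simp [hu]
    · intro b _ hb
      rw [if_neg]
      intro hb'
      exact hb (T.par_unique hb' hu)
    · simp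

lemma degree_eq (T : RTree V) (v : V) :
    (T.degree v : ℝ) = ∑ u, if T.G.Adj v u then (1 : ℝ) else 0 := by
  unfold degree
  rw [Nat.card_eq_fintype_card, Fintype.card_subtype, Finset.sum_boole]
  simp

lemma moment_eq (T : RTree V) :
    (T.moment : ℝ) = 2 * ∑ v, (T.G.dist v T.root : ℝ) - ((Fintype.card V : ℝ) - 1) := by
  have h1 : (T.moment : ℝ) = ∑ v, ∑ u, if T.G.Adj v u then (T.G.dist v T.root : ℝ) else 0 := by
    unfold moment
    push_cast
    refine Finset.sum_congr rfl fun v _ => ?_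
    rw [degree_eq, Finset.mul_sum]
    simp
  have h2 : ∀ v u, (if T.G.Adj v u then (T.G.dist v T.root : ℝ) else 0) =
      (if T.par v u then (T.G.dist v T.root : ℝ) else 0) +
      (if T.par u v then (T.G.dist u T.root : ℝ) - 1 else 0) := by
    intro v u
    rw [T.adj_iff]
    by_cases a : T.par v u <;> by_cases b : T.par u v
    · exact (T.not_both a b).elim
    · simp [a, b]
    · have := b.2
      simp [a, b, ← this]
    · simp [a, b]
  rw [h1]
  simp_rw [h2, Finset.sum_add_distrib]
  rw [Finset.sum_comm (f := fun v u => if T.par u v then (T.G.dist u T.root : ℝ) - 1 else 0)]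
  simp_rw [sum_par]
  have h3 : ∀ v, (if v = T.root then (0:ℝ) else (T.G.dist v T.root : ℝ)) = T.G.dist v T.root := by
    intro v
    split_ifs with h
    · simp [h]
    · rfl
  have h4 : ∀ v, (if v = T.root then (0:ℝ) else (T.G.dist v T.root : ℝ) - 1) =
      T.G.dist v T.root - 1 + if v = T.root then 1 else 0 := by
    intro v
    split_ifs with h
    · simp [h]
    · simp
  simp_rw [h3, h4, Finset.sum_add_distrib, Finset.sum_sub_distrib]
  simp
  ring

/-- the sum of a vector over the branch at `k` -/
noncomputable def bsum (T : RTree V) (w : V → ℝ) (k : V) : ℝ :=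
  ∑ j, if T.pord j k then w j else 0

lemma bsum_root (T : RTree V) (w : V → ℝ) : T.bsum w T.root = ∑ j, w j := by
  simp [bsum, pord_root]

lemma mulVec_eq (T : RTree V) (w : V → ℝ) (i : V) :
    (T.bottleneck *ᵥ w) i = ∑ k, if T.pord i k then T.bsum w k else 0 := by
  have h : ∀ i j, T.bottleneck i j =
      ∑ k, (if T.pord i k then (if T.pord j k then (1:ℝ) else 0) else 0) := by
    intro i j
    simp only [← ite_and]
    rw [Finset.sum_boole]
    simp only [bottleneck, Matrix.of_apply]
    rw [Nat.card_eq_fintype_card, Fintype.card_subtype]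
    simp
  simp only [Matrix.mulVec, dotProduct, h, Finset.sum_mul]
  rw [Finset.sum_comm]
  refine Finset.sum_congr rfl fun k _ => ?_
  by_cases hk : T.pord i k <;> simp [hk, bsum]

lemma quad_eq (T : RTree V) (w : V → ℝ) :
    ∑ i, w i * (T.bottleneck *ᵥ w) i = ∑ k, T.bsum w k ^ 2 := by
  simp only [mulVec_eq, Finset.mul_sum]
  rw [Finset.sum_comm]
  refine Finset.sum_congr rfl fun k _ => ?_
  rw [pow_two]
  conv_rhs => enter [1]; unfold bsum
  rw [Finset.sum_mul]
  refine Finset.sum_congr rfl fun i _ => ?_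
  split_ifs <;> simp

/-- strict descendants -/
noncomputable def desc (T : RTree V) (k : V) : Finset V :=
  Finset.univ.filter fun j => T.pord j k ∧ j ≠ k

lemma bsum_eq (T : RTree V) (w : V → ℝ) (k : V) :
    T.bsum w k = w k + ∑ j ∈ T.desc k, w j := by
  unfold bsum desc
  rw [← Finset.sum_filter]
  have : Finset.univ.filter (fun j => T.pord j k) =
      insert k (Finset.univ.filter fun j => T.pord j k ∧ j ≠ k) := by
    ext j
    by_cases h : j = k
    · subst h; simp [pord_self]
    · simp [h]
  rw [this, Finset.sum_insert (by simp)]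

lemma bsum_sq_le (T : RTree V) (w : V → ℝ) (k : V) :
    T.bsum w k ^ 2 ≤ w k ^ 2 + 7 / 4 * (T.desc k).card * ∑ j, w j ^ 2 := by
  rw [bsum_eq]
  set Y := ∑ j ∈ T.desc k, w j with hY
  have hcs : Y ^ 2 ≤ (T.desc k).card * ∑ j ∈ T.desc k, w j ^ 2 := sq_sum_le_card_mul_sum_sq
  have hsub : w k ^ 2 + ∑ j ∈ T.desc k, w j ^ 2 ≤ ∑ j, w j ^ 2 := by
    rw [← Finset.sum_insert (f := fun j => w j ^ 2) (a := k) (by simp [desc])]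
    exact Finset.sum_le_sum_of_subset_of_nonneg (Finset.subset_univ _)
      fun _ _ _ => sq_nonneg _
  rcases Nat.eq_zero_or_pos (T.desc k).card with h0 | h0
  · have : T.desc k = ∅ := Finset.card_eq_zero.mp h0
    simp [hY, this]
  · have hm : (1:ℝ) ≤ (T.desc k).card := by exact_mod_cast h0
    set m : ℝ := ((T.desc k).card : ℝ)
    have e1 := mul_le_mul_of_nonneg_left hsub (by linarith : (0:ℝ) ≤ m)
    have e2 := mul_le_mul_of_nonneg_right hm (sq_nonneg (w k))
    have e3 := sq_nonneg (7 / 4 * w k - Y)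
    nlinarith [sq_nonneg Y]

lemma sum_desc_le (T : RTree V) :
    ∑ k, (if k = T.root then (0:ℝ) else (T.desc k).card) ≤
      ∑ v, (T.G.dist v T.root : ℝ) - ((Fintype.card V : ℝ) - 1) := by
  have hcard : ∀ i, ((Finset.univ.filter fun k => T.pord i k ∧ k ≠ T.root).card) ≤
      T.G.dist i T.root := by
    intro i
    have : (Finset.Icc 1 (T.G.dist i T.root)).card = T.G.dist i T.root := by simp
    rw [← this]
    refine Finset.card_le_card_of_injOn (fun k => T.G.dist k T.root) ?_ ?_
    · intro k hk
      simp only [Finset.coe_filter, Finset.mem_univ, true_and, Set.mem_setOf_eq] at hk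
      have h1 := hk.1
      have h2 := T.isTree.connected.pos_dist_of_ne hk.2
      unfold pord at h1
      simp only [Finset.coe_Icc, Set.mem_Icc]
      omega
    · intro k hk k' hk' e
      simp only [Finset.coe_filter, Finset.mem_univ, true_and, Set.mem_setOf_eq] at hk hk'
      exact T.pord_unique hk.1 hk'.1 e
  have h1 : ∀ k, (if k = T.root then (0:ℝ) else (T.desc k).card) =
      (∑ i, if T.pord i k ∧ k ≠ T.root then (1:ℝ) else 0) - 1 + if k = T.root then 1 else 0 := by
    intro k
    have hb := T.bsum_eq (fun _ => 1) k
    unfold bsum at hb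
    by_cases h : k = T.root
    · simp [h]
    · simp only [h, if_false, ne_eq, not_false_eq_true, and_true]
      rw [hb]
      simp
  simp_rw [h1, Finset.sum_add_distrib, Finset.sum_sub_distrib]
  rw [Finset.sum_comm]
  have h2 : ∑ i, ∑ k, (if T.pord i k ∧ k ≠ T.root then (1:ℝ) else 0) ≤
      ∑ v, (T.G.dist v T.root : ℝ) := by
    refine Finset.sum_le_sum fun i _ => ?_
    rw [Finset.sum_boole]
    exact_mod_cast hcard i
  simp
  simp at h2
  linarith

/-- Perron value of the star -/
noncomputable def rs (n : ℝ) : ℝ := (n + 1 + Real.sqrt (n ^ 2 + 2 * n - 3)) / 2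

lemma rs_sq {n : ℝ} (hn : 1 ≤ n) : (rs n - 1) ^ 2 = (n - 1) * rs n := by
  have := Real.sq_sqrt (show 0 ≤ n ^ 2 + 2 * n - 3 by nlinarith)
  unfold rs
  nlinarith

lemma rs_ge {n : ℝ} : (n + 1) / 2 ≤ rs n := by
  have := Real.sqrt_nonneg (n ^ 2 + 2 * n - 3)
  unfold rs
  linarith

lemma star_quad (T : RTree V) (w : V → ℝ) :
    (∑ j, w j) ^ 2 + (∑ j, w j ^ 2 - w T.root ^ 2) ≤ rs (Fintype.card V) * ∑ j, w j ^ 2 := by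
  have hn : 1 ≤ Fintype.card V := Fintype.card_pos_iff.mpr ⟨T.root⟩
  set D := Finset.univ.erase T.root with hD
  have hcs : (∑ j ∈ D, w j) ^ 2 ≤ D.card * ∑ j ∈ D, w j ^ 2 := sq_sum_le_card_mul_sum_sq
  have hc : (D.card : ℝ) = Fintype.card V - 1 := by
    rw [hD, Finset.card_erase_of_mem (Finset.mem_univ _), Finset.card_univ]
    push_cast [hn]
    rfl
  rw [← Finset.add_sum_erase Finset.univ w (Finset.mem_univ T.root),
    ← Finset.add_sum_erase Finset.univ (fun j => w j ^ 2) (Finset.mem_univ T.root)]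
  rw [← hD]
  rw [hc] at hcs
  have hy : 0 ≤ ∑ j ∈ D, w j ^ 2 := Finset.sum_nonneg fun _ _ => sq_nonneg _
  have hn' : (1:ℝ) ≤ Fintype.card V := by exact_mod_cast hn
  set N : ℝ := (Fintype.card V : ℝ)
  have hr := rs_sq hn'
  have hr1 := rs_ge (n := N)
  set r := rs N
  set Y := ∑ j ∈ D, w j
  set y := ∑ j ∈ D, w j ^ 2
  set a := w T.root
  show (a + Y) ^ 2 + (a ^ 2 + y - a ^ 2) ≤ r * (a ^ 2 + y)
  rcases eq_or_lt_of_le hn' with h1 | h1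
  · rw [← h1] at hcs hr
    have : r = 1 := by nlinarith
    have : Y = 0 := by nlinarith
    rw [‹r = 1›, this]; linarith
  · have hq : 0 < r - 1 := by linarith
    have e1 := sq_nonneg ((r - 1) * a - Y)
    have e2 := mul_le_mul_of_nonneg_left hcs (by linarith : 0 ≤ r)
    have : (r - 1) * ((a + Y) ^ 2 + (a ^ 2 + y - a ^ 2)) ≤ (r - 1) * (r * (a ^ 2 + y)) := by
      have e3 : r * ((N - 1) * y) = (r - 1) ^ 2 * y := by rw [hr]; ring
      nlinarith
    exact le_of_mul_le_mul_left this hq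

lemma quad_le (T : RTree V) (w : V → ℝ) :
    ∑ k, T.bsum w k ^ 2 ≤ (rs (Fintype.card V) + 7 / 4 *
      (∑ v, (T.G.dist v T.root : ℝ) - ((Fintype.card V : ℝ) - 1))) * ∑ j, w j ^ 2 := by
  set W := ∑ j, w j ^ 2 with hW
  have hW0 : 0 ≤ W := Finset.sum_nonneg fun _ _ => sq_nonneg _
  have h1 : ∀ k, T.bsum w k ^ 2 ≤ (w k ^ 2 + 7 / 4 * W *
      (if k = T.root then (0:ℝ) else (T.desc k).card)) +
      (if k = T.root then (∑ j, w j) ^ 2 - w T.root ^ 2 else 0) := by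
    intro k
    by_cases h : k = T.root
    · subst h
      simp [bsum_root]
    · have := T.bsum_sq_le w k
      simp only [h, if_false]
      linarith
  have h2 := Finset.sum_le_sum fun k (_ : k ∈ Finset.univ) => h1 k
  rw [Finset.sum_add_distrib, Finset.sum_add_distrib, ← Finset.mul_sum] at h2
  simp only [Finset.sum_ite_eq', Finset.sum_ite_eq, Finset.mem_univ, if_true] at h2
  have h3 := mul_le_mul_of_nonneg_left T.sum_desc_le (by linarith : 0 ≤ 7 / 4 * W)
  have h4 := T.star_quad w
  linarith

lemma eig_le (T : RTree V) {t : ℝ}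
    (ht : t ∈ {t : ℝ | ∃ w : V → ℝ, w ≠ 0 ∧ T.bottleneck *ᵥ w = t • w}) :
    t ≤ rs (Fintype.card V) + 7 / 4 *
      (∑ v, (T.G.dist v T.root : ℝ) - ((Fintype.card V : ℝ) - 1)) := by
  obtain ⟨w, hw, he⟩ := ht
  have h1 := T.quad_eq w
  have h2 := T.quad_le w
  rw [← h1, he] at h2
  have h3 : ∑ i, w i * (t • w) i = t * ∑ j, w j ^ 2 := by
    rw [Finset.mul_sum]
    refine Finset.sum_congr rfl fun i _ => ?_
    simp; ring
  rw [h3] at h2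
  refine le_of_mul_le_mul_right h2 ?_
  obtain ⟨i, hi⟩ := Function.ne_iff.mp hw
  exact Finset.sum_pos' (fun _ _ => sq_nonneg _) ⟨i, Finset.mem_univ _, by
    have : w i ≠ 0 := hi
    positivity⟩

lemma dist_sum_ge (T : RTree V) :
    (Fintype.card V : ℝ) - 1 ≤ ∑ v, (T.G.dist v T.root : ℝ) := by
  refine le_trans ?_ (sub_nonneg.mp (le_trans ?_ T.sum_desc_le))
  · exact le_rfl
  · exact Finset.sum_nonneg fun k _ => by split_ifs <;> positivity

lemma dist_sum_star (T : RTree V) (h : ∀ v : V, v ≠ T.root → T.G.Adj T.root v) :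
    ∑ v, (T.G.dist v T.root : ℝ) = (Fintype.card V : ℝ) - 1 := by
  have : ∀ v, (T.G.dist v T.root : ℝ) = 1 - if v = T.root then 1 else 0 := by
    intro v
    split_ifs with hv
    · simp [hv]
    · rw [dist_eq_one_iff_adj.mpr (h v hv).symm]; simp
  simp_rw [this, Finset.sum_sub_distrib]
  simp

lemma star_of_dist_sum (T : RTree V)
    (h : ∑ v, (T.G.dist v T.root : ℝ) ≤ (Fintype.card V : ℝ) - 1) :
    ∀ v : V, v ≠ T.root → T.G.Adj T.root v := by
  have e : ∑ v, (1 - if v = T.root then (1:ℝ) else 0) = (Fintype.card V : ℝ) - 1 := by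
    rw [Finset.sum_sub_distrib]; simp
  have hle : ∀ v ∈ Finset.univ, (1 - if v = T.root then (1:ℝ) else 0) ≤ T.G.dist v T.root := by
    intro v _
    split_ifs with hv
    · simp
    · have := T.isTree.connected.pos_dist_of_ne hv
      have : (1:ℝ) ≤ T.G.dist v T.root := by exact_mod_cast this
      linarith
  have heq := (Finset.sum_eq_sum_iff_of_le hle).mp
    (le_antisymm (Finset.sum_le_sum hle) (e ▸ h))
  intro v hv
  have := heq v (Finset.mem_univ _)
  simp only [hv, if_false, sub_zero] at this
  exact (dist_eq_one_iff_adj.mp (by exact_mod_cast this.symm)).symm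

lemma star_eig (T : RTree V) (h : ∀ v : V, v ≠ T.root → T.G.Adj T.root v) :
    rs (Fintype.card V) ∈ {t : ℝ | ∃ w : V → ℝ, w ≠ 0 ∧ T.bottleneck *ᵥ w = t • w} := by
  have hp : ∀ i k, T.pord i k ↔ k = T.root ∨ k = i := by
    intro i k
    constructor
    · intro hik
      by_contra hc
      push Not at hc
      have h1 := dist_eq_one_iff_adj.mpr (h k hc.1).symm
      have h2 := T.isTree.connected.pos_dist_of_ne hc.2
      rw [dist_comm] at h2
      unfold pord at hik
      have hi : i ≠ T.root := by
        rintro rfl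
        simp at hik
        omega
      have h3 := dist_eq_one_iff_adj.mpr (h i hi).symm
      omega
    · rintro (rfl | rfl)
      · exact T.pord_root i
      · exact T.pord_self k
  have hn : 1 ≤ Fintype.card V := Fintype.card_pos_iff.mpr ⟨T.root⟩
  have hn' : (1:ℝ) ≤ Fintype.card V := by exact_mod_cast hn
  have hr := rs_sq hn'
  have hr1 := rs_ge (n := (Fintype.card V : ℝ))
  set r := rs (Fintype.card V) with hrdef
  set w : V → ℝ := fun v => r / (r - 1) + if v = T.root then 1 - r / (r - 1) else 0 with hwdef
  have hroot : w T.root = 1 := by simp [hwdef]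
  have hother : ∀ v, v ≠ T.root → w v = r / (r - 1) := by intro v hv; simp [hwdef, hv]
  have hsum : ∑ v, w v = r := by
    have : ∑ v, w v = Fintype.card V * (r / (r - 1)) + (1 - r / (r - 1)) := by
      rw [hwdef, Finset.sum_add_distrib]; simp
    rw [this]
    rcases eq_or_lt_of_le hn' with h1 | h1
    · rw [← h1] at hr ⊢
      have : r = 1 := by nlinarith
      rw [this]; simp
    · have : r - 1 ≠ 0 := by linarith
      field_simp
      nlinarith
  refine ⟨w, ?_, ?_⟩
  · intro h0
    rw [h0] at hroot
    simp at hroot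
  · funext i
    rw [mulVec_eq]
    have hb : ∀ k, k ≠ T.root → T.bsum w k = w k := by
      intro k hk
      unfold bsum
      rw [Finset.sum_eq_single k]
      · simp [pord_self]
      · intro j _ hj
        rw [if_neg]
        rw [hp]
        push Not
        exact ⟨hk, hj.symm⟩
      · simp
    have : ∀ k, (if T.pord i k then T.bsum w k else 0) =
        (if k = T.root then r else 0) + (if k = i then (if i = T.root then 0 else w i) else 0) := by
      intro k
      by_cases hk : k = T.root
      · subst hk
        simp only [pord_root, if_true, bsum_root, hsum]
        by_cases hi : T.root = i
        · simp [hi]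
        · simp [hi]
      · rw [hb k hk]
        by_cases hki : k = i
        · subst hki
          simp [pord_self, hk]
        · have : ¬ T.pord i k := by rw [hp]; tauto
          simp [this, hk, hki]
    simp_rw [this, Finset.sum_add_distrib]
    simp only [Finset.sum_ite_eq', Finset.mem_univ, if_true, Pi.smul_apply, smul_eq_mul]
    by_cases hi : i = T.root
    · subst hi
      simp [hroot]
    · simp only [hi, if_false]
      rw [hother i hi]
      have h2 : 1 < Fintype.card V := Fintype.one_lt_card_iff.mpr ⟨i, T.root, hi⟩
      have h2' : (1:ℝ) < Fintype.card V := by exact_mod_cast h2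
      have : r - 1 ≠ 0 := by linarith
      field_simp
      ring

end RTree

theorem moment_ge_perron_sub_f {V : Type} [Fintype V] (T : RTree V)
    (n : ℕ) (hn : n = Fintype.card V) :
    T.perron - (Real.sqrt ((n : ℝ) ^ 2 + 2 * n - 3) - n + 3) / 2 ≤ (T.moment : ℝ) ∧
      ((T.moment : ℝ) = T.perron - (Real.sqrt ((n : ℝ) ^ 2 + 2 * n - 3) - n + 3) / 2 ↔
        ∀ v : V, v ≠ T.root → T.G.Adj T.root v) := by
  subst hn
  have hm := T.moment_eq
  have hd := T.dist_sum_ge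
  have hr : RTree.rs (Fintype.card V) = (Real.sqrt ((Fintype.card V : ℝ) ^ 2 + 2 *
      (Fintype.card V : ℝ) - 3) - (Fintype.card V : ℝ) + 3) / 2 + (Fintype.card V : ℝ) - 1 := by
    unfold RTree.rs; ring
  have hr0 : 0 ≤ RTree.rs (Fintype.card V) := le_trans (by positivity) RTree.rs_ge
  have hle : T.perron ≤ RTree.rs (Fintype.card V) + 7 / 4 *
      (∑ v, (T.G.dist v T.root : ℝ) - ((Fintype.card V : ℝ) - 1)) :=
    Real.sSup_le (fun t ht => T.eig_le ht) (by linarith)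
  refine ⟨by linarith, ?_, ?_⟩
  · intro h
    exact T.star_of_dist_sum (by linarith)
  · intro h
    have hs := T.dist_sum_star h
    have hge : RTree.rs (Fintype.card V) ≤ T.perron :=
      le_csSup ⟨_, fun t ht => T.eig_le ht⟩ (T.star_eig h)
    linarith
end

section
/- Let (T,r) be a rooted tree of order n with path matrix N and degree vector γ (the vector whose i-th entry is the degree of vertex i in T). Then N(2e − γ) = e + e_r, where e is the all-ones vector and e_r the standard unit vector indexed by the root r. -/
open Matrix SimpleGraph
open scoped Kronecker

attribute [local instance 10] Classical.propDecidable

theorem RTree.exists_step {V : Type} (T : RTree V) (u w : V) (h : u ≠ w) :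
    ∃ x, T.G.Adj u x ∧ T.G.dist u w = T.G.dist x w + 1 := by
  obtain ⟨p, hp⟩ := T.isTree.connected.exists_walk_length_eq_dist u w
  cases p with
  | nil => exact absurd rfl h
  | @cons _ x _ hadj q =>
    refine ⟨x, hadj, ?_⟩
    have h1 := SimpleGraph.dist_le q
    have h2 := T.isTree.connected.dist_triangle (u := u) (v := x) (w := w)
    have h3 : T.G.dist u x = 1 := SimpleGraph.dist_eq_one_iff_adj.2 hadj
    simp only [SimpleGraph.Walk.length_cons] at hp
    omega

theorem RTree.step_unique {V : Type} (T : RTree V) (u w x y : V)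
    (hx : T.G.Adj u x) (hy : T.G.Adj u y) (hdx : T.G.dist u w = T.G.dist x w + 1)
    (hdy : T.G.dist u w = T.G.dist y w + 1) : x = y := by
  obtain ⟨p, hp⟩ := T.isTree.connected.exists_walk_length_eq_dist x w
  obtain ⟨q, hq⟩ := T.isTree.connected.exists_walk_length_eq_dist y w
  have h1 : (SimpleGraph.Walk.cons hx p).IsPath :=
    SimpleGraph.Walk.isPath_of_length_eq_dist _ (by simp [hp, hdx])
  have h2 : (SimpleGraph.Walk.cons hy q).IsPath :=
    SimpleGraph.Walk.isPath_of_length_eq_dist _ (by simp [hq, hdy])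
  have h3 := (T.isTree.existsUnique_path u w).unique h1 h2
  have h4 := congrArg SimpleGraph.Walk.snd h3
  simpa using h4

/-- For a rooted tree with path matrix `N` and degree vector `γ`,
`N(2e − γ) = e + e_root`. -/
theorem pathMatrix_mulVec_two_sub_degree {V : Type} [Fintype V] (T : RTree V) :
    T.pathMatrix *ᵥ (fun i : V => 2 - (T.degree i : ℝ)) =
      fun i : V => 1 + if i = T.root then 1 else 0 := by
  have hex : ∀ u, ∃ x, u ≠ T.root → T.G.Adj u x ∧
      T.G.dist u T.root = T.G.dist x T.root + 1 := by
    intro u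
    by_cases h : u = T.root
    · exact ⟨u, fun h' => absurd h h'⟩
    · obtain ⟨x, hx⟩ := T.exists_step u T.root h
      exact ⟨x, fun _ => hx⟩
  choose p hp using hex
  have hadj : ∀ v u, (if T.G.Adj v u then (1 : ℝ) else 0) =
      (if v ≠ T.root ∧ u = p v then 1 else 0) + (if u ≠ T.root ∧ v = p u then 1 else 0) := by
    intro v u
    by_cases h : T.G.Adj v u
    · have hd := T.isTree.dist_eq_dist_add_one_of_adj T.root h
      rw [SimpleGraph.dist_comm (v := v), SimpleGraph.dist_comm (v := u)] at hd
      rcases hd with hd | hd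
      · have hv : v ≠ T.root := by rintro rfl; simp at hd
        have e : u = p v := T.step_unique v T.root u (p v) h (hp v hv).1 hd (hp v hv).2
        have n : ¬ (u ≠ T.root ∧ v = p u) := by
          rintro ⟨h1, h2⟩
          have := (hp u h1).2
          rw [← h2] at this
          omega
        rw [if_pos h, if_pos ⟨hv, e⟩, if_neg n]; norm_num
      · have hu : u ≠ T.root := by rintro rfl; simp at hd
        have e : v = p u := T.step_unique u T.root v (p u) h.symm (hp u hu).1 hd (hp u hu).2
        have n : ¬ (v ≠ T.root ∧ u = p v) := by
          rintro ⟨h1, h2⟩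
          have := (hp v h1).2
          rw [← h2] at this
          omega
        rw [if_pos h, if_neg n, if_pos ⟨hu, e⟩]; norm_num
    · have n1 : ¬ (v ≠ T.root ∧ u = p v) := by
        rintro ⟨h1, h2⟩
        exact h (h2 ▸ (hp v h1).1)
      have n2 : ¬ (u ≠ T.root ∧ v = p u) := by
        rintro ⟨h1, h2⟩
        exact h (h2 ▸ (hp u h1).1.symm)
      rw [if_neg h, if_neg n1, if_neg n2]; norm_num
  have hdeg : ∀ v, (T.degree v : ℝ) = ∑ u, if T.G.Adj v u then (1 : ℝ) else 0 := by
    intro v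
    rw [RTree.degree, Finset.sum_boole, Nat.card_eq_fintype_card, Fintype.card_subtype]
    simp
  funext i
  set a : V → ℝ := fun j => if T.pord j i then 1 else 0 with ha
  have hpa : ∀ u, u ≠ T.root → a (p u) = a u - if u = i then 1 else 0 := by
    intro u hu
    obtain ⟨h1, h2⟩ := hp u hu
    have h3 : T.G.dist u (p u) = 1 := SimpleGraph.dist_eq_one_iff_adj.2 h1
    by_cases hui : u = i
    · subst hui
      have n : ¬ T.pord (p u) u := by
        unfold RTree.pord
        omega
      have y : T.pord u u := by simp [RTree.pord]
      simp [ha, n, y]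
    · have : T.pord (p u) i ↔ T.pord u i := by
        unfold RTree.pord
        have t1 := T.isTree.connected.dist_triangle (u := u) (v := p u) (w := i)
        have t2 := T.isTree.connected.dist_triangle (u := u) (v := i) (w := T.root)
        constructor
        · intro h; omega
        · intro h
          obtain ⟨x, hx1, hx2⟩ := T.exists_step u i hui
          have h4 : T.G.dist u x = 1 := SimpleGraph.dist_eq_one_iff_adj.2 hx1
          have t3 := T.isTree.connected.dist_triangle (u := x) (v := i) (w := T.root)
          have t4 := T.isTree.connected.dist_triangle (u := u) (v := x) (w := T.root)
          have e : x = p u := T.step_unique u T.root x (p u) hx1 h1 (by omega) h2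
          rw [← e]
          omega
      simp [ha, this, hui]
  have har : a T.root = if i = T.root then 1 else 0 := by
    have : T.pord T.root i ↔ i = T.root := by
      unfold RTree.pord
      constructor
      · intro h
        rw [SimpleGraph.dist_self] at h
        exact T.isTree.connected.dist_eq_zero_iff.1 (by omega)
      · rintro rfl; simp
    simp [ha, this]
  have key : ∑ v, a v * (T.degree v : ℝ) =
      ∑ v, if v ≠ T.root then 2 * a v - (if v = i then 1 else 0) else 0 := by
    have s1 : ∀ v, a v * (T.degree v : ℝ) = (if v ≠ T.root then a v else 0) +
        ∑ u, if u ≠ T.root ∧ v = p u then a v else 0 := by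
      intro v
      rw [hdeg, Finset.sum_congr rfl (fun u _ => hadj v u), Finset.sum_add_distrib, mul_add,
        Finset.mul_sum, Finset.mul_sum]
      congr 1
      · by_cases hv : v = T.root <;> simp [hv]
      · simp
    rw [Finset.sum_congr rfl (fun v _ => s1 v), Finset.sum_add_distrib, Finset.sum_comm,
      ← Finset.sum_add_distrib]
    refine Finset.sum_congr rfl fun u _ => ?_
    by_cases hu : u = T.root
    · simp [hu]
    · simp only [ne_eq, hu, not_false_eq_true, true_and, if_true, Finset.sum_ite_eq',
        Finset.mem_univ, hpa u hu]
      ring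
  have main : ∑ v, a v * (2 - (T.degree v : ℝ)) = 1 + if i = T.root then 1 else 0 := by
    simp only [mul_sub, Finset.sum_sub_distrib]
    rw [key, ← Finset.sum_sub_distrib]
    have s2 : ∀ v, (a v * 2 - if v ≠ T.root then 2 * a v - (if v = i then (1:ℝ) else 0) else 0) =
        (if v = T.root then 2 * a T.root - (if i = T.root then (1:ℝ) else 0) else 0)
          + (if v = i then 1 else 0) := by
      intro v
      by_cases hv : v = T.root
      · subst hv
        simp only [ne_eq, not_true_eq_false, if_false, if_true, eq_comm (a := i)]
        ring
      · simp only [ne_eq, hv, not_false_eq_true, if_false, if_true]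
        ring
    rw [Finset.sum_congr rfl (fun v _ => s2 v), Finset.sum_add_distrib]
    simp only [Finset.sum_ite_eq', Finset.mem_univ, if_true, har]
    ring
  exact main
end

section
/- Let T be a rooted tree of order n. Then μ(T) ≤ (n − 1)², with equality if and only if T is (isomorphic as a rooted tree to) the rooted path P_n. -/
open Matrix SimpleGraph
open scoped Kronecker

attribute [local instance 10] Classical.propDecidable

namespace RTree

variable {V : Type}

theorem exists_parent (T : RTree V) (v : V) (k : ℕ) (h : T.G.dist v T.root = k + 1) :
    ∃ u, T.G.Adj v u ∧ T.G.dist u T.root = k := by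
  obtain ⟨w, hw⟩ := T.isTree.connected.exists_walk_length_eq_dist v T.root
  cases w with
  | nil => simp at h
  | @cons _ u _ hadj q =>
    refine ⟨u, hadj, ?_⟩
    have h1 : q.length + 1 = k + 1 := by rw [← h, ← hw]; simp
    have h2 := SimpleGraph.dist_le q
    have h3 := T.isTree.connected.dist_triangle (u := v) (v := u) (w := T.root)
    have h4 : T.G.dist v u = 1 := SimpleGraph.dist_eq_one_iff_adj.mpr hadj
    omega

theorem exists_parentFun (T : RTree V) :
    ∃ p : V → V, ∀ v, v ≠ T.root →
      T.G.Adj v (p v) ∧ T.G.dist (p v) T.root + 1 = T.G.dist v T.root := by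
  have : ∀ v, ∃ u, v ≠ T.root → T.G.Adj v u ∧ T.G.dist u T.root + 1 = T.G.dist v T.root := by
    intro v
    by_cases hv : v = T.root
    · exact ⟨v, fun h => absurd hv h⟩
    · have := T.isTree.connected.pos_dist_of_ne hv
      obtain ⟨u, h1, h2⟩ := T.exists_parent v (T.G.dist v T.root - 1) (by omega)
      exact ⟨u, fun _ => ⟨h1, by omega⟩⟩
  choose p hp using this
  exact ⟨p, hp⟩

theorem exists_level (T : RTree V) (j : ℕ) : ∀ i v, T.G.dist v T.root = i + j →
    ∃ w, T.G.dist w T.root = i := by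
  induction j with
  | zero => intro i v h; exact ⟨v, h⟩
  | succ j ih =>
    intro i v h
    obtain ⟨u, -, hu⟩ := T.exists_parent v (i + j) (by omega)
    exact ih i u hu

variable [Fintype V]

theorem dist_le_card (T : RTree V) (v : V) : T.G.dist v T.root ≤
    (Finset.univ.filter fun w => T.G.dist w T.root < T.G.dist v T.root).card := by
  have hsub : Finset.range (T.G.dist v T.root) ⊆
      (Finset.univ.filter fun w => T.G.dist w T.root < T.G.dist v T.root).image
        (fun w => T.G.dist w T.root) := by
    intro i hi
    rw [Finset.mem_range] at hi
    obtain ⟨w, hw⟩ := T.exists_level (T.G.dist v T.root - i) i v (by omega)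
    simp only [Finset.mem_image, Finset.mem_filter, Finset.mem_univ, true_and]
    exact ⟨w, by omega, hw⟩
  calc T.G.dist v T.root = (Finset.range (T.G.dist v T.root)).card := by simp
    _ ≤ _ := Finset.card_le_card hsub
    _ ≤ _ := Finset.card_image_le

theorem dist_lt_card (T : RTree V) (v : V) : T.G.dist v T.root < Fintype.card V := by
  refine (T.dist_le_card v).trans_lt ?_
  rw [← Finset.card_univ]
  apply Finset.card_lt_card
  rw [Finset.ssubset_univ_iff]
  intro h
  have : v ∈ (Finset.univ.filter fun w => T.G.dist w T.root < T.G.dist v T.root) := by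
    rw [h]; simp
  simp at this

theorem edge_bij (T : RTree V) (p : V → V) (hp : ∀ v, v ≠ T.root →
      T.G.Adj v (p v) ∧ T.G.dist (p v) T.root + 1 = T.G.dist v T.root) :
    Set.InjOn (fun v => s(v, p v)) ((Finset.univ.erase T.root : Finset V) : Set V) ∧
    (Finset.univ.erase T.root).image (fun v => s(v, p v)) = T.G.edgeFinset := by
  have hinj : Set.InjOn (fun v => s(v, p v)) ((Finset.univ.erase T.root : Finset V) : Set V) := by
    intro a ha b hb hab
    have ha' : a ≠ T.root := by simpa using ha
    have hb' : b ≠ T.root := by simpa using hb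
    have h1 := (hp a ha').2
    have h2 := (hp b hb').2
    simp only [Sym2.eq_iff] at hab
    rcases hab with h | ⟨h3, h4⟩
    · exact h.1
    · rw [h4] at h1
      rw [← h3] at h2
      omega
  refine ⟨hinj, ?_⟩
  apply Finset.eq_of_subset_of_card_le
  · intro e he
    simp only [Finset.mem_image, Finset.mem_erase, Finset.mem_univ, and_true] at he
    obtain ⟨v, hv, rfl⟩ := he
    rw [SimpleGraph.mem_edgeFinset]
    exact (hp v hv).1
  · rw [Finset.card_image_of_injOn hinj]
    have := T.isTree.card_edgeFinset
    rw [Finset.card_erase_of_mem (Finset.mem_univ _), Finset.card_univ]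
    omega

theorem adj_dist (T : RTree V) (u v : V) (h : T.G.Adj u v) :
    T.G.dist u T.root + 1 = T.G.dist v T.root ∨ T.G.dist v T.root + 1 = T.G.dist u T.root := by
  obtain ⟨p, hp⟩ := T.exists_parentFun
  have h1 : s(u, v) ∈ T.G.edgeFinset := by rw [SimpleGraph.mem_edgeFinset]; exact h
  rw [← (T.edge_bij p hp).2] at h1
  simp only [Finset.mem_image, Finset.mem_erase, Finset.mem_univ, and_true] at h1
  obtain ⟨w, hw, he⟩ := h1
  have h2 := (hp w hw).2
  rw [Sym2.eq_iff] at he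
  rcases he with ⟨rfl, rfl⟩ | ⟨rfl, rfl⟩
  · right; exact h2
  · left; exact h2

theorem moment_add (T : RTree V) :
    T.moment + (Fintype.card V - 1) = 2 * ∑ v : V, T.G.dist v T.root := by
  obtain ⟨p, hp⟩ := T.exists_parentFun
  obtain ⟨hinj, himg⟩ := T.edge_bij p hp
  have hdeg : ∀ v, T.degree v = ∑ e ∈ T.G.edgeFinset, if v ∈ e then 1 else 0 := by
    intro v
    rw [← Finset.card_filter]
    have h1 : T.degree v = T.G.degree v := by
      unfold RTree.degree
      rw [← SimpleGraph.card_neighborSet_eq_degree, Nat.card_eq_fintype_card]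
      exact Fintype.card_congr (Equiv.refl _)
    rw [h1, ← SimpleGraph.card_incidenceFinset_eq_degree, SimpleGraph.incidenceFinset_eq_filter]
  have h2 : T.moment = ∑ v ∈ Finset.univ.erase T.root,
      (T.G.dist v T.root + T.G.dist (p v) T.root) := by
    unfold RTree.moment
    simp_rw [hdeg, Finset.mul_sum]
    rw [Finset.sum_comm, ← himg, Finset.sum_image hinj]
    apply Finset.sum_congr rfl
    intro v hv
    have hv' : v ≠ T.root := by simpa using hv
    have hne : v ≠ p v := (hp v hv').1.ne
    simp only [mul_ite, mul_one, mul_zero]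
    rw [← Finset.sum_filter]
    have : (Finset.univ.filter fun x => x ∈ s(v, p v)) = {v, p v} := by
      ext x; simp
    rw [this, Finset.sum_pair hne]
  have h3 : Fintype.card V - 1 = ∑ v ∈ Finset.univ.erase T.root, 1 := by
    rw [Finset.sum_const, Finset.card_erase_of_mem (Finset.mem_univ _), Finset.card_univ]; simp
  rw [h2, h3, ← Finset.sum_add_distrib, ← Finset.add_sum_erase _ _ (Finset.mem_univ T.root),
    SimpleGraph.dist_self, zero_add, Finset.mul_sum]
  apply Finset.sum_congr rfl
  intro v hv
  have hv' : v ≠ T.root := by simpa using hv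
  have := (hp v hv').2
  omega

theorem two_sum_le (T : RTree V) : 2 * ∑ v : V, T.G.dist v T.root ≤
    ∑ v : V, ∑ w : V, if T.G.dist v T.root ≠ T.G.dist w T.root then 1 else 0 := by
  have h1 : ∑ v : V, T.G.dist v T.root ≤
      ∑ v : V, ∑ w : V, if T.G.dist w T.root < T.G.dist v T.root then 1 else 0 := by
    apply Finset.sum_le_sum
    intro v _
    rw [← Finset.card_filter]
    exact T.dist_le_card v
  have h2 := h1
  rw [Finset.sum_comm] at h2
  have h3 := add_le_add h1 h2
  rw [← two_mul, ← Finset.sum_add_distrib] at h3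
  refine h3.trans (le_of_eq ?_)
  apply Finset.sum_congr rfl
  intro v _
  rw [← Finset.sum_add_distrib]
  apply Finset.sum_congr rfl
  intro w _
  split_ifs <;> omega

theorem sum_ne_eq : (∑ v : V, ∑ w : V, if v ≠ w then 1 else 0) =
    Fintype.card V * (Fintype.card V - 1) := by
  have : ∀ v : V, (∑ w : V, if v ≠ w then 1 else 0) = Fintype.card V - 1 := by
    intro v
    rw [← Finset.card_filter, Finset.filter_ne, Finset.card_erase_of_mem (Finset.mem_univ _),
      Finset.card_univ]
  rw [Finset.sum_congr rfl fun v _ => this v]; simp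

theorem term_le (T : RTree V) (v w : V) :
    (if T.G.dist v T.root ≠ T.G.dist w T.root then 1 else 0) ≤ (if v ≠ w then 1 else 0 : ℕ) := by
  by_cases h : v = w
  · subst h; simp
  · simp only [ne_eq, h, not_false_eq_true, if_true]; split_ifs <;> omega

theorem two_sum_le' (T : RTree V) : 2 * ∑ v : V, T.G.dist v T.root ≤
    Fintype.card V * (Fintype.card V - 1) := by
  rw [← sum_ne_eq]
  exact T.two_sum_le.trans
    (Finset.sum_le_sum fun v _ => Finset.sum_le_sum fun w _ => T.term_le v w)

theorem inj_of_eq (T : RTree V) (h : 2 * ∑ v : V, T.G.dist v T.root =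
    Fintype.card V * (Fintype.card V - 1)) :
    Function.Injective fun v => T.G.dist v T.root := by
  intro a b hab
  by_contra hne
  have h1 : (∑ v : V, ∑ w : V, if T.G.dist v T.root ≠ T.G.dist w T.root then 1 else 0) <
      ∑ v : V, ∑ w : V, if v ≠ w then 1 else 0 := by
    apply Finset.sum_lt_sum
    · exact fun v _ => Finset.sum_le_sum fun w _ => T.term_le v w
    · refine ⟨a, Finset.mem_univ _, Finset.sum_lt_sum (fun w _ => T.term_le a w)
        ⟨b, Finset.mem_univ _, ?_⟩⟩
      have hab' : T.G.dist a T.root = T.G.dist b T.root := hab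
      simp [hab', hne]
  rw [sum_ne_eq, ← h] at h1
  exact absurd T.two_sum_le (not_le.mpr h1)

end RTree

/-- Every rooted tree `T` of order `n` satisfies `μ(T) ≤ (n − 1)²`,
with equality if and only if `T` is (isomorphic as a rooted tree to) the rooted path
`P_n`, i.e. there is a bijective labelling of the vertices by `Fin n` sending the root
to `0` under which adjacency is consecutiveness. -/
theorem moment_le_sq {V : Type} [Fintype V] (T : RTree V)
    (n : ℕ) (hn : n = Fintype.card V) :
    (T.moment : ℝ) ≤ ((n : ℝ) - 1) ^ 2 ∧
      ((T.moment : ℝ) = ((n : ℝ) - 1) ^ 2 ↔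
        ∃ g : V ≃ Fin n, (g T.root : ℕ) = 0 ∧
          ∀ u v : V, T.G.Adj u v ↔
            ((g u : ℕ) + 1 = (g v : ℕ) ∨ (g v : ℕ) + 1 = (g u : ℕ))) := by
  subst hn
  have hpos : 1 ≤ Fintype.card V := Fintype.card_pos_iff.mpr ⟨T.root⟩
  have hm := T.moment_add
  have hle := T.two_sum_le'
  have hm' : (T.moment : ℝ) + ((Fintype.card V : ℝ) - 1) =
      ((2 * ∑ v : V, T.G.dist v T.root : ℕ) : ℝ) := by
    rw [← hm]; push_cast [hpos]; ring
  have hle' : ((2 * ∑ v : V, T.G.dist v T.root : ℕ) : ℝ) ≤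
      (Fintype.card V : ℝ) * ((Fintype.card V : ℝ) - 1) := by
    have : ((2 * ∑ v : V, T.G.dist v T.root : ℕ) : ℝ) ≤
      ((Fintype.card V * (Fintype.card V - 1) : ℕ) : ℝ) := by exact_mod_cast hle
    refine this.trans (le_of_eq ?_)
    push_cast [hpos]; ring
  refine ⟨by nlinarith, ?_, ?_⟩
  · intro heq
    have h2 : 2 * ∑ v : V, T.G.dist v T.root = Fintype.card V * (Fintype.card V - 1) := by
      have : ((2 * ∑ v : V, T.G.dist v T.root : ℕ) : ℝ) =
          ((Fintype.card V * (Fintype.card V - 1) : ℕ) : ℝ) := by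
        rw [← hm', heq, Nat.cast_mul, Nat.cast_sub hpos, Nat.cast_one]; ring
      exact_mod_cast this
    have hinj := T.inj_of_eq h2
    let f : V → Fin (Fintype.card V) := fun v => ⟨T.G.dist v T.root, T.dist_lt_card v⟩
    have hf : Function.Injective f := by
      intro a b hab
      exact hinj (Fin.mk.inj_iff.mp hab)
    have hbij : Function.Bijective f :=
      (Fintype.bijective_iff_injective_and_card f).mpr ⟨hf, by simp⟩
    refine ⟨Equiv.ofBijective f hbij, by simp [f], ?_⟩
    intro u v
    simp only [Equiv.ofBijective_apply, f]
    constructor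
    · exact T.adj_dist u v
    · rintro (h | h)
      · obtain ⟨w, hw, hd⟩ := T.exists_parent v _ h.symm
        have : w = u := hinj hd
        subst this
        exact hw.symm
      · obtain ⟨w, hw, hd⟩ := T.exists_parent u _ h.symm
        have : w = v := hinj hd
        subst this
        exact hw
  · rintro ⟨g, hg0, hg⟩
    have hd1 : ∀ k, ∀ v, (g v : ℕ) = k → T.G.dist v T.root ≤ k := by
      intro k
      induction k with
      | zero =>
        intro v hv
        have : v = T.root := g.injective (Fin.ext (by omega))
        simp [this]
      | succ k ih =>
        intro v hv
        have hk : k < Fintype.card V := by have := (g v).2; omega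
        have hgu : (g (g.symm ⟨k, hk⟩) : ℕ) = k := by simp
        have hadj : T.G.Adj v (g.symm ⟨k, hk⟩) := (hg _ _).mpr (by right; omega)
        have h3 := T.isTree.connected.dist_triangle (u := v) (v := g.symm ⟨k, hk⟩) (w := T.root)
        have h4 := SimpleGraph.dist_eq_one_iff_adj.mpr hadj
        have h5 := ih _ hgu
        omega
    have hd2 : ∀ k, ∀ v, T.G.dist v T.root = k → (g v : ℕ) ≤ k := by
      intro k
      induction k with
      | zero =>
        intro v hv
        have : v = T.root := T.isTree.connected.dist_eq_zero_iff.mp hv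
        rw [this]; omega
      | succ k ih =>
        intro v hv
        obtain ⟨u, hu, hk⟩ := T.exists_parent v k hv
        have h1 := ih u hk
        have h2 := (hg _ _).mp hu
        omega
    have hd : ∀ v, T.G.dist v T.root = (g v : ℕ) := fun v =>
      le_antisymm (hd1 _ v rfl) (hd2 _ v rfl)
    have hs : 2 * ∑ v : V, T.G.dist v T.root = Fintype.card V * (Fintype.card V - 1) := by
      simp_rw [hd]
      rw [Equiv.sum_comp g (fun i => (i : ℕ)), Fin.sum_univ_eq_sum_range (fun i => i), mul_comm,
        Finset.sum_range_id_mul_two]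
    rw [hs, Nat.cast_mul, Nat.cast_sub hpos, Nat.cast_one] at hm'
    linarith
end

section
/- Let T be a rooted tree of order n. Then μ(T) < (4/7)·n·ρ(T), where μ is the moment and ρ the Perron value. -/
open Matrix SimpleGraph
open scoped Kronecker

attribute [local instance 10] Classical.propDecidable

namespace RTree

variable {V : Type}

lemma ancestors_card [Fintype V] (T : RTree V) (i : V) :
    T.G.dist i T.root + 1 ≤ (Finset.univ.filter fun v => T.pord i v).card := by
  classical
  obtain ⟨p, hp, hl⟩ := T.isTree.connected.exists_path_of_dist i T.root
  have h1 : p.support.toFinset.card = T.G.dist i T.root + 1 := by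
    rw [List.toFinset_card_of_nodup hp.support_nodup, Walk.length_support, hl]
  rw [← h1]
  apply Finset.card_le_card
  intro v hv
  rw [List.mem_toFinset] at hv
  rw [Finset.mem_filter]
  refine ⟨Finset.mem_univ _, ?_⟩
  unfold pord
  have h2 := congrArg Walk.length (p.take_spec hv)
  rw [Walk.length_append] at h2
  have h3 := dist_le (p.takeUntil v hv)
  have h4 := dist_le (p.dropUntil v hv)
  have h5 := T.isTree.connected.dist_triangle (u := i) (v := v) (w := T.root)
  omega

lemma parent_unique (T : RTree V) {v a b : V} (ha : T.G.Adj v a) (hb : T.G.Adj v b)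
    (hda : T.G.dist v T.root = T.G.dist a T.root + 1)
    (hdb : T.G.dist v T.root = T.G.dist b T.root + 1) : a = b := by
  obtain ⟨p, hp, hl⟩ := T.isTree.connected.exists_path_of_dist a T.root
  obtain ⟨q, hq, hm⟩ := T.isTree.connected.exists_path_of_dist b T.root
  have h1 : (Walk.cons ha p).IsPath := Walk.isPath_of_length_eq_dist _ (by simp [hl, hda])
  have h2 : (Walk.cons hb q).IsPath := Walk.isPath_of_length_eq_dist _ (by simp [hm, hdb])
  have h3 := (T.isTree.existsUnique_path v T.root).unique h1 h2
  have h4 := congrArg Walk.snd h3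
  simpa using h4

lemma moment_le [Fintype V] (T : RTree V) : T.moment ≤ 2 * T.transmission := by
  classical
  set d : V → ℕ := fun v => T.G.dist v T.root with hd
  let C : V → V → ℕ := fun v u => if T.G.Adj v u ∧ d u = d v + 1 then 1 else 0
  have hpar : ∀ v, ∑ u, C u v ≤ 1 := by
    intro v
    simp only [C]
    rw [← Finset.card_filter, Finset.card_le_one]
    intro a ha b hb
    rw [Finset.mem_filter] at ha hb
    exact T.parent_unique ha.2.1.symm hb.2.1.symm ha.2.2 hb.2.2
  have hdeg : ∀ v, T.degree v = ∑ u, (C v u + C u v) := by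
    intro v
    unfold degree
    rw [Nat.card_eq_fintype_card, Fintype.card_subtype, Finset.card_filter]
    refine Finset.sum_congr rfl fun u _ => ?_
    simp only [C]
    by_cases h : T.G.Adj v u
    · have h' := T.isTree.dist_eq_dist_add_one_of_adj T.root h
      rw [dist_comm (u := T.root), dist_comm (u := T.root)] at h'
      have hs := h.symm
      simp only [Set.mem_ofPred_eq, h, hs, true_and, if_true, hd]
      rcases h' with h' | h' <;> simp [h'] <;> omega
    · have hs : ¬ T.G.Adj u v := fun k => h k.symm
      simp [h, hs]
  unfold moment transmission
  calc ∑ v, d v * T.degree v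
      = ∑ v, ∑ u, d v * C v u + ∑ v, ∑ u, d v * C u v := by
        rw [← Finset.sum_add_distrib]
        refine Finset.sum_congr rfl fun v _ => ?_
        rw [hdeg, Finset.mul_sum, ← Finset.sum_add_distrib]
        exact Finset.sum_congr rfl fun u _ => by ring
    _ ≤ ∑ v, ∑ u, d u * C v u + ∑ v, ∑ u, d v * C u v := by
        gcongr ?_ + _
        refine Finset.sum_le_sum fun v _ => Finset.sum_le_sum fun u _ => ?_
        simp only [C]
        split_ifs with h
        · omega
        · simp
    _ = 2 * ∑ v, d v * ∑ u, C u v := by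
        rw [Finset.sum_comm, two_mul]
        simp only [Finset.mul_sum]
    _ ≤ 2 * ∑ v, d v := by
        gcongr with v
        calc d v * _ ≤ d v * 1 := Nat.mul_le_mul_left _ (hpar v)
          _ = d v := mul_one _

lemma exists_eigen [Fintype V] [Nonempty V] (M : Matrix V V ℝ) (hM : M.IsHermitian) (c : ℝ)
    (hc : c * Fintype.card V ≤ ∑ i, ∑ j, M i j) :
    ∃ t, c ≤ t ∧ ∃ w : V → ℝ, w ≠ 0 ∧ M *ᵥ w = t • w := by
  classical
  by_contra! hcon
  have hA : (c • (1 : Matrix V V ℝ) - M).IsHermitian := by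
    apply Matrix.IsHermitian.sub _ hM
    ext i j
    simp [Matrix.one_apply, eq_comm]
  have hpos : (c • (1 : Matrix V V ℝ) - M).PosDef := by
    rw [hA.posDef_iff_eigenvalues_pos]
    intro i
    by_contra! hi
    have h1 := hA.mulVec_eigenvectorBasis i
    refine hcon (c - hA.eigenvalues i) (by linarith) (hA.eigenvectorBasis i) ?_ ?_
    · intro h0
      have := hA.eigenvectorBasis.orthonormal.ne_zero i
      exact this (by ext j; exact congrFun h0 j)
    · rw [Matrix.sub_mulVec, Matrix.smul_mulVec, Matrix.one_mulVec] at h1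
      rw [sub_smul, ← h1]
      abel
  have h := hpos.dotProduct_mulVec_pos (x := fun _ => (1 : ℝ)) (by
    intro h0
    have := congrFun h0 (Classical.arbitrary V)
    simp at this)
  rw [Matrix.sub_mulVec, Matrix.smul_mulVec, Matrix.one_mulVec] at h
  simp [dotProduct, Matrix.mulVec] at h
  linarith

lemma le_perron [Fintype V] [Nonempty V] (T : RTree V) (c : ℝ)
    (hc : c * Fintype.card V ≤ ∑ i, ∑ j, T.bottleneck i j) : c ≤ T.perron := by
  classical
  have hM : T.bottleneck.IsHermitian := by
    ext i j
    simp [bottleneck, and_comm]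
  obtain ⟨t, hct, ht⟩ := exists_eigen T.bottleneck hM c hc
  refine hct.trans (le_csSup ?_ ht)
  have hfin := Module.End.finite_hasEigenvalue (Matrix.toLin' T.bottleneck)
  refine (hfin.subset ?_).bddAbove
  rintro s ⟨w, hw, hs⟩
  exact Module.End.hasEigenvalue_of_hasEigenvector
    ⟨Module.End.mem_eigenspace_iff.2 (by simpa using hs), hw⟩

end RTree

/-- Every rooted tree `T` of order `n` satisfies
`μ(T) < (4/7)·n·ρ(T)`. -/
theorem moment_lt_perron {V : Type} [Fintype V] (T : RTree V)
    (n : ℕ) (hn : n = Fintype.card V) :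
    (T.moment : ℝ) < 4 / 7 * n * T.perron := by
  classical
  have : Nonempty V := ⟨T.root⟩
  have hn0 : (0 : ℝ) < n := by
    rw [hn]
    exact_mod_cast Fintype.card_pos
  let e : V → V → ℝ := fun i v => if T.pord i v then 1 else 0
  let s : V → ℝ := fun v => ∑ i, e i v
  have hB : ∑ i, ∑ j, T.bottleneck i j = ∑ v, s v ^ 2 := by
    have h1 : ∀ i j, T.bottleneck i j = ∑ v, e i v * e j v := by
      intro i j
      simp only [RTree.bottleneck, Matrix.of_apply, e]
      rw [Nat.card_eq_fintype_card, Fintype.card_subtype, Finset.card_filter]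
      push_cast
      refine Finset.sum_congr rfl fun v _ => ?_
      by_cases h : T.pord i v <;> by_cases h' : T.pord j v <;> simp [h, h']
    simp only [h1, s, sq, Finset.sum_mul_sum]
    calc ∑ i, ∑ j, ∑ v, e i v * e j v = ∑ i, ∑ v, ∑ j, e i v * e j v :=
          Finset.sum_congr rfl fun i _ => Finset.sum_comm
      _ = _ := Finset.sum_comm
  have hp : (∑ v, s v ^ 2) / n ≤ T.perron := by
    apply T.le_perron
    rw [hB, ← hn, div_mul_cancel₀ _ hn0.ne']
  have hp' : ∑ v, s v ^ 2 ≤ n * T.perron := by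
    rw [div_le_iff₀ hn0] at hp
    linarith
  have hs : (T.transmission : ℝ) + n ≤ ∑ v, s v := by
    have h1 : ∑ v, s v = ∑ i, ∑ v, e i v := Finset.sum_comm
    have h2 : (T.transmission : ℝ) + n = ∑ i, ((T.G.dist i T.root : ℝ) + 1) := by
      rw [Finset.sum_add_distrib, hn]
      simp [RTree.transmission]
    rw [h1, h2]
    refine Finset.sum_le_sum fun i _ => ?_
    have h3 := T.ancestors_card i
    simp only [e, Finset.sum_boole]
    exact_mod_cast h3
  have hq : ∑ v, (2 * s v - 7 / 4) ≤ ∑ v, 4 / 7 * s v ^ 2 :=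
    Finset.sum_le_sum fun v _ => by nlinarith [sq_nonneg (s v - 7 / 4)]
  rw [Finset.sum_sub_distrib, ← Finset.mul_sum, ← Finset.mul_sum] at hq
  simp only [Finset.sum_const, Finset.card_univ, ← hn, nsmul_eq_mul] at hq
  have hm : (T.moment : ℝ) ≤ 2 * T.transmission := by exact_mod_cast T.moment_le
  linarith
end
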